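/- arXiv:2207.01544 — 8 statements merged into one kernel-verified Lean document; each statement's English description precedes it below -/
import Mathlib

section
/- Let (X, ‖·‖) be a real normed space and let τ > −1 be a real number. Then there exist constants c, C > 0 depending only on τ such that for all nonzero u, v ∈ X one has c · (‖u‖ + ‖v‖)^τ · ‖u − v‖ ≤ ‖ ‖u‖^τ • u − ‖v‖^τ • v ‖ ≤ C · (‖u‖ + ‖v‖)^τ · ‖u − v‖. -/
/-- Normalised scalar estimate behind the upper bound for the V-functional. -/
lemma abs_one_sub_rpow_mul_self_le {τ t : ℝ} (hτ : -1 < τ) (ht : 0 < t) (ht1 : t ≤ 1) :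
    |1 - t ^ τ| * t ≤ (|τ| + 1) * (1 - t) := by
  have hmul : t ^ τ * t = t ^ (τ + 1) := (Real.rpow_add_one ht.ne' τ).symm
  rcases le_total 0 τ with h | h
  · have h1 : t ^ τ ≤ 1 := Real.rpow_le_one ht.le ht1 h
    have h2 := one_add_mul_self_le_rpow_one_add (s := t - 1) (by linarith)
      (p := τ + 1) (by linarith)
    rw [add_sub_cancel] at h2
    rw [abs_of_nonneg (by linarith), abs_of_nonneg h, sub_mul, hmul]
    linarith
  · have h1 : 1 ≤ t ^ τ := Real.one_le_rpow_of_pos_of_le_one_of_nonpos ht ht1 h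
    have h2 : t ^ (τ + 1) ≤ 1 := Real.rpow_le_one ht.le ht1 (by linarith)
    rw [abs_of_nonpos (by linarith), neg_sub, sub_mul, hmul]
    nlinarith [mul_nonneg (abs_nonneg τ) (sub_nonneg.2 ht1)]

lemma abs_rpow_sub_rpow_mul_le {τ a b : ℝ} (hτ : -1 < τ) (hb : 0 < b) (hba : b ≤ a) :
    |a ^ τ - b ^ τ| * b ≤ (|τ| + 1) * a ^ τ * (a - b) := by
  have ha : 0 < a := hb.trans_le hba
  obtain ⟨t, rfl⟩ : ∃ t, b = a * t := ⟨b / a, by field_simp⟩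
  have ht : 0 < t := pos_of_mul_pos_right hb ha.le
  have ht1 : t ≤ 1 := by nlinarith
  have hpow : 0 < a ^ τ := Real.rpow_pos_of_pos ha τ
  have key := mul_le_mul_of_nonneg_left (abs_one_sub_rpow_mul_self_le hτ ht ht1)
    (mul_pos hpow ha).le
  rw [Real.mul_rpow ha.le ht.le, ← mul_one_sub, abs_mul, abs_of_pos hpow]
  linarith

section VFunctional

variable {X : Type*} [NormedAddCommGroup X] [NormedSpace ℝ X]

lemma norm_rpow_smul_self {τ : ℝ} {u : X} (hu : u ≠ 0) :
    ‖(‖u‖ ^ τ) • u‖ = ‖u‖ ^ (τ + 1) := by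
  rw [norm_smul, Real.norm_of_nonneg (by positivity),
    Real.rpow_add_one (norm_ne_zero_iff.2 hu)]

lemma norm_rpow_smul_sub_le {τ : ℝ} (hτ : -1 < τ) {u v : X} (hv : v ≠ 0) (hvu : ‖v‖ ≤ ‖u‖) :
    ‖(‖u‖ ^ τ) • u - (‖v‖ ^ τ) • v‖ ≤ (|τ| + 2) * ‖u‖ ^ τ * ‖u - v‖ := by
  have hsplit : (‖u‖ ^ τ) • u - (‖v‖ ^ τ) • v
      = (‖u‖ ^ τ) • (u - v) + (‖u‖ ^ τ - ‖v‖ ^ τ) • v := by module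
  have hpow : 0 ≤ ‖u‖ ^ τ := by positivity
  have h1 := abs_rpow_sub_rpow_mul_le hτ (norm_pos_iff.2 hv) hvu
  have h2 : (|τ| + 1) * ‖u‖ ^ τ * (‖u‖ - ‖v‖) ≤ (|τ| + 1) * ‖u‖ ^ τ * ‖u - v‖ :=
    mul_le_mul_of_nonneg_left (norm_sub_norm_le u v) (by positivity)
  have h3 := norm_add_le ((‖u‖ ^ τ) • (u - v)) ((‖u‖ ^ τ - ‖v‖ ^ τ) • v)
  rw [norm_smul, norm_smul, Real.norm_of_nonneg hpow, Real.norm_eq_abs] at h3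
  rw [hsplit]
  linarith

/-- `V_σ` with `σ = -τ / (τ + 1)` is a left inverse of `V_τ`. -/
lemma rpow_smul_rpow_smul_self {τ : ℝ} (hτ : -1 < τ) {u : X} (hu : u ≠ 0) :
    (‖(‖u‖ ^ τ) • u‖ ^ (-τ / (τ + 1))) • ((‖u‖ ^ τ) • u) = u := by
  have hτ' : τ + 1 ≠ 0 := by linarith
  have hpos : 0 < ‖u‖ := norm_pos_iff.2 hu
  rw [norm_rpow_smul_self hu, ← Real.rpow_mul hpos.le, mul_div_cancel₀ _ hτ', smul_smul,
    ← Real.rpow_add hpos, neg_add_cancel, Real.rpow_zero, one_smul]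

lemma rpow_mul_norm_sub_le {τ : ℝ} (hτ : -1 < τ) {u v : X} (hv : v ≠ 0) (hvu : ‖v‖ ≤ ‖u‖) :
    ‖u‖ ^ τ * ‖u - v‖ ≤ (|-τ / (τ + 1)| + 2) * ‖(‖u‖ ^ τ) • u - (‖v‖ ^ τ) • v‖ := by
  have hτ' : 0 < τ + 1 := by linarith
  have hvpos : 0 < ‖v‖ := norm_pos_iff.2 hv
  have hupos : 0 < ‖u‖ := hvpos.trans_le hvu
  have hu : u ≠ 0 := norm_pos_iff.1 hupos
  have hσ : -1 < -τ / (τ + 1) := by rw [lt_div_iff₀ hτ']; linarith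
  have hVv : (‖v‖ ^ τ) • v ≠ 0 := smul_ne_zero (Real.rpow_pos_of_pos hvpos τ).ne' hv
  have hV : ‖(‖v‖ ^ τ) • v‖ ≤ ‖(‖u‖ ^ τ) • u‖ := by
    rw [norm_rpow_smul_self hu, norm_rpow_smul_self hv]
    exact Real.rpow_le_rpow hvpos.le hvu hτ'.le
  have key := norm_rpow_smul_sub_le hσ hVv hV
  rw [rpow_smul_rpow_smul_self hτ hu, rpow_smul_rpow_smul_self hτ hv, norm_rpow_smul_self hu,
    ← Real.rpow_mul hupos.le, mul_div_cancel₀ _ hτ'.ne'] at key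
  have hcancel : ‖u‖ ^ τ * ‖u‖ ^ (-τ) = 1 := by
    rw [← Real.rpow_add hupos, add_neg_cancel, Real.rpow_zero]
  calc ‖u‖ ^ τ * ‖u - v‖
      ≤ ‖u‖ ^ τ * ((|-τ / (τ + 1)| + 2) * ‖u‖ ^ (-τ) *
          ‖(‖u‖ ^ τ) • u - (‖v‖ ^ τ) • v‖) := by gcongr
    _ = (‖u‖ ^ τ * ‖u‖ ^ (-τ)) * ((|-τ / (τ + 1)| + 2) *
          ‖(‖u‖ ^ τ) • u - (‖v‖ ^ τ) • v‖) := by ring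
    _ = _ := by rw [hcancel, one_mul]

end VFunctional

/-- Powers of two comparable positive numbers are comparable. -/
lemma rpow_le_two_rpow_abs_mul_rpow {x y : ℝ} (τ : ℝ) (hx : 0 < x) (hy : 0 < y)
    (hxy : x ≤ 2 * y) (hyx : y ≤ 2 * x) : x ^ τ ≤ 2 ^ |τ| * y ^ τ := by
  rcases le_total 0 τ with h | h
  · rw [abs_of_nonneg h, ← Real.mul_rpow zero_le_two hy.le]
    exact Real.rpow_le_rpow hx.le hxy h
  · have h1 : (2 * x) ^ τ ≤ y ^ τ := Real.rpow_le_rpow_of_nonpos hy hyx h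
    rw [Real.mul_rpow zero_le_two hx.le] at h1
    rw [abs_of_nonpos h]
    calc x ^ τ = 2 ^ (-τ) * (2 ^ τ * x ^ τ) := by
          rw [← mul_assoc, ← Real.rpow_add two_pos, neg_add_cancel, Real.rpow_zero, one_mul]
      _ ≤ _ := by gcongr

/-- The two-sided V-functional equivalence: for a real normed space `X` and `τ > -1`,
`‖ ‖u‖^τ • u - ‖v‖^τ • v ‖ ∼ (‖u‖ + ‖v‖)^τ ‖u - v‖` with constants depending only on `τ`. -/
theorem v_functional_equivalence (τ : ℝ) (hτ : -1 < τ) :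
    ∃ c C : ℝ, 0 < c ∧ 0 < C ∧
      ∀ (X : Type*) [NormedAddCommGroup X] [NormedSpace ℝ X] (u v : X),
        u ≠ 0 → v ≠ 0 →
          c * (‖u‖ + ‖v‖) ^ τ * ‖u - v‖ ≤ ‖(‖u‖ ^ τ) • u - (‖v‖ ^ τ) • v‖ ∧
          ‖(‖u‖ ^ τ) • u - (‖v‖ ^ τ) • v‖ ≤ C * (‖u‖ + ‖v‖) ^ τ * ‖u - v‖ := by
  refine ⟨(2 ^ |τ| * (|-τ / (τ + 1)| + 2))⁻¹, (|τ| + 2) * 2 ^ |τ|, by positivity,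
    by positivity, ?_⟩
  intro X _ _ u v hu hv
  wlog hvu : ‖v‖ ≤ ‖u‖ generalizing u v
  · have h := this v u hv hu (le_of_not_ge hvu)
    rwa [add_comm ‖v‖, norm_sub_rev v u, norm_sub_rev ((‖v‖ ^ τ) • v)] at h
  have hupos : 0 < ‖u‖ := norm_pos_iff.2 hu
  have hvpos : 0 < ‖v‖ := norm_pos_iff.2 hv
  constructor
  · rw [mul_assoc, inv_mul_le_iff₀ (by positivity)]
    have h1 : (‖u‖ + ‖v‖) ^ τ ≤ 2 ^ |τ| * ‖u‖ ^ τ :=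
      rpow_le_two_rpow_abs_mul_rpow τ (by positivity) hupos (by linarith) (by linarith)
    calc (‖u‖ + ‖v‖) ^ τ * ‖u - v‖ ≤ 2 ^ |τ| * ‖u‖ ^ τ * ‖u - v‖ := by gcongr
      _ = 2 ^ |τ| * (‖u‖ ^ τ * ‖u - v‖) := by ring
      _ ≤ 2 ^ |τ| * ((|-τ / (τ + 1)| + 2) * ‖(‖u‖ ^ τ) • u - (‖v‖ ^ τ) • v‖) :=
        mul_le_mul_of_nonneg_left (rpow_mul_norm_sub_le hτ hv hvu) (by positivity)
      _ = _ := by ring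
  · have h1 : ‖u‖ ^ τ ≤ 2 ^ |τ| * (‖u‖ + ‖v‖) ^ τ :=
      rpow_le_two_rpow_abs_mul_rpow τ hupos (by positivity) (by linarith) (by linarith)
    calc ‖(‖u‖ ^ τ) • u - (‖v‖ ^ τ) • v‖ ≤ (|τ| + 2) * ‖u‖ ^ τ * ‖u - v‖ :=
          norm_rpow_smul_sub_le hτ hv hvu
      _ ≤ (|τ| + 2) * (2 ^ |τ| * (‖u‖ + ‖v‖) ^ τ) * ‖u - v‖ := by gcongr
      _ = _ := by ring
end

section
/- Let (X, ‖·‖) be a real normed space and let τ ≥ 0 be a real number. Then there exists a constant C > 0 depending only on τ such that for all u, v ∈ X one has ‖ ‖u‖^τ • u − ‖v‖^τ • v ‖ ≤ C · (‖u‖ + ‖v‖)^τ · ‖u − v‖. -/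
theorem rpow_sub_rpow_mul_le {τ a b : ℝ} (hτ : 0 ≤ τ) (hb : 0 ≤ b) (hab : b ≤ a) :
    (a ^ τ - b ^ τ) * b ≤ τ * a ^ τ * (a - b) := by
  have ha : 0 ≤ a := hb.trans hab
  rcases hb.eq_or_lt with rfl | hb'
  · simpa using mul_nonneg (mul_nonneg hτ (Real.rpow_nonneg ha τ)) ha
  have ha' : 0 < a := hb'.trans_le hab
  have hlog : 1 - a / b ≤ Real.log (b / a) := by
    simpa using Real.one_sub_inv_le_log_of_pos (div_pos hb' ha')
  have hexp : 1 + τ * (1 - a / b) ≤ (b / a) ^ τ := by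
    rw [Real.rpow_def_of_pos (div_pos hb' ha')]
    have h := Real.add_one_le_exp (Real.log (b / a) * τ)
    nlinarith
  rw [Real.div_rpow hb ha, le_div_iff₀ (Real.rpow_pos_of_pos ha' τ)] at hexp
  have h := mul_le_mul_of_nonneg_right hexp hb
  have hcancel : (1 + τ * (1 - a / b)) * a ^ τ * b = a ^ τ * b - τ * a ^ τ * (a - b) := by
    field_simp
    ring
  linarith

theorem norm_rpow_smul_sub_le_of_norm_le {X : Type*} [NormedAddCommGroup X] [NormedSpace ℝ X]
    {τ : ℝ} (hτ : 0 ≤ τ) {u v : X} (h : ‖v‖ ≤ ‖u‖) :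
    ‖(‖u‖ ^ τ) • u - (‖v‖ ^ τ) • v‖ ≤ (1 + τ) * (‖u‖ + ‖v‖) ^ τ * ‖u - v‖ := by
  have hsplit : (‖u‖ ^ τ) • u - (‖v‖ ^ τ) • v
      = (‖u‖ ^ τ) • (u - v) + (‖u‖ ^ τ - ‖v‖ ^ τ) • v := by
    module
  have hmono : ‖v‖ ^ τ ≤ ‖u‖ ^ τ := Real.rpow_le_rpow (norm_nonneg v) h hτ
  calc ‖(‖u‖ ^ τ) • u - (‖v‖ ^ τ) • v‖
      ≤ ‖u‖ ^ τ * ‖u - v‖ + (‖u‖ ^ τ - ‖v‖ ^ τ) * ‖v‖ := by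
        rw [hsplit]
        refine (norm_add_le _ _).trans_eq ?_
        rw [norm_smul, norm_smul, Real.norm_of_nonneg (Real.rpow_nonneg (norm_nonneg u) τ),
          Real.norm_of_nonneg (sub_nonneg.2 hmono)]
    _ ≤ ‖u‖ ^ τ * ‖u - v‖ + τ * ‖u‖ ^ τ * (‖u‖ - ‖v‖) := by
        exact add_le_add_right (rpow_sub_rpow_mul_le hτ (norm_nonneg v) h) _
    _ ≤ ‖u‖ ^ τ * ‖u - v‖ + τ * ‖u‖ ^ τ * ‖u - v‖ := by
        gcongr
        exact norm_sub_norm_le u v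
    _ = (1 + τ) * ‖u‖ ^ τ * ‖u - v‖ := by ring
    _ ≤ (1 + τ) * (‖u‖ + ‖v‖) ^ τ * ‖u - v‖ := by
        gcongr
        exact le_add_of_nonneg_right (norm_nonneg v)

/-- Upper bound for the V-functional for `τ ≥ 0`, with constant depending only on `τ`. -/
theorem v_functional_upper_nonneg (τ : ℝ) (hτ : 0 ≤ τ) :
    ∃ C : ℝ, 0 < C ∧
      ∀ (X : Type*) [NormedAddCommGroup X] [NormedSpace ℝ X] (u v : X),
        ‖(‖u‖ ^ τ) • u - (‖v‖ ^ τ) • v‖ ≤ C * (‖u‖ + ‖v‖) ^ τ * ‖u - v‖ := by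
  refine ⟨1 + τ, by positivity, fun X _ _ u v => ?_⟩
  rcases le_total ‖v‖ ‖u‖ with h | h
  · exact norm_rpow_smul_sub_le_of_norm_le hτ h
  · rw [norm_sub_rev, norm_sub_rev u v, add_comm ‖u‖]
    exact norm_rpow_smul_sub_le_of_norm_le hτ h
end

section
/- Let (X, ‖·‖) be a real normed space and let τ ≥ 0 be a real number. Then there exists a constant c > 0 depending only on τ such that for all u, v ∈ X one has c · (‖u‖ + ‖v‖)^τ · ‖u − v‖ ≤ ‖ ‖u‖^τ • u − ‖v‖^τ • v ‖. -/
/-- If `‖v‖ ≤ ‖u‖`, then `‖u‖ ^ τ * ‖u - v‖` is at most twice the distance between the values of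
the V-functional at `u` and `v`. -/
theorem norm_rpow_mul_norm_sub_le {X : Type*} [NormedAddCommGroup X] [NormedSpace ℝ X]
    {τ : ℝ} (hτ : 0 ≤ τ) {u v : X} (h : ‖v‖ ≤ ‖u‖) :
    ‖u‖ ^ τ * ‖u - v‖ ≤ 2 * ‖(‖u‖ ^ τ) • u - (‖v‖ ^ τ) • v‖ := by
  have hu : 0 ≤ ‖u‖ ^ τ := Real.rpow_nonneg (norm_nonneg u) τ
  have hv : 0 ≤ ‖v‖ ^ τ := Real.rpow_nonneg (norm_nonneg v) τ
  have hvu : ‖v‖ ^ τ ≤ ‖u‖ ^ τ := Real.rpow_le_rpow (norm_nonneg v) h hτ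
  have hnorm : ‖u‖ ^ τ * ‖u‖ - ‖v‖ ^ τ * ‖v‖ ≤ ‖(‖u‖ ^ τ) • u - (‖v‖ ^ τ) • v‖ := by
    simpa only [norm_smul_of_nonneg hu, norm_smul_of_nonneg hv] using
      norm_sub_norm_le ((‖u‖ ^ τ) • u) ((‖v‖ ^ τ) • v)
  have hsplit : (‖u‖ ^ τ) • (u - v) =
      ((‖u‖ ^ τ) • u - (‖v‖ ^ τ) • v) - (‖u‖ ^ τ - ‖v‖ ^ τ) • v := by
    module
  calc ‖u‖ ^ τ * ‖u - v‖ = ‖(‖u‖ ^ τ) • (u - v)‖ := (norm_smul_of_nonneg hu _).symm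
    _ ≤ ‖(‖u‖ ^ τ) • u - (‖v‖ ^ τ) • v‖ + (‖u‖ ^ τ - ‖v‖ ^ τ) * ‖v‖ := by
      rw [hsplit, ← norm_smul_of_nonneg (sub_nonneg.2 hvu)]
      exact norm_sub_le _ _
    _ ≤ 2 * ‖(‖u‖ ^ τ) • u - (‖v‖ ^ τ) • v‖ := by
      linarith [mul_le_mul_of_nonneg_left h hu]

/-- The lower bound for the V-functional with an explicit constant, for `‖v‖ ≤ ‖u‖`. -/
theorem norm_add_norm_rpow_mul_norm_sub_le {X : Type*} [NormedAddCommGroup X] [NormedSpace ℝ X]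
    {τ : ℝ} (hτ : 0 ≤ τ) {u v : X} (h : ‖v‖ ≤ ‖u‖) :
    (2 * 2 ^ τ)⁻¹ * (‖u‖ + ‖v‖) ^ τ * ‖u - v‖ ≤ ‖(‖u‖ ^ τ) • u - (‖v‖ ^ τ) • v‖ := by
  have h2 : (0 : ℝ) < 2 ^ τ := Real.rpow_pos_of_pos two_pos τ
  have hsum : (‖u‖ + ‖v‖) ^ τ ≤ 2 ^ τ * ‖u‖ ^ τ := by
    rw [← Real.mul_rpow two_pos.le (norm_nonneg u)]
    exact Real.rpow_le_rpow (by positivity) (by linarith) hτ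
  rw [mul_assoc, inv_mul_le_iff₀ (by positivity)]
  calc (‖u‖ + ‖v‖) ^ τ * ‖u - v‖ ≤ 2 ^ τ * ‖u‖ ^ τ * ‖u - v‖ := by gcongr
    _ = 2 ^ τ * (‖u‖ ^ τ * ‖u - v‖) := mul_assoc _ _ _
    _ ≤ 2 ^ τ * (2 * ‖(‖u‖ ^ τ) • u - (‖v‖ ^ τ) • v‖) :=
      mul_le_mul_of_nonneg_left (norm_rpow_mul_norm_sub_le hτ h) h2.le
    _ = 2 * 2 ^ τ * ‖(‖u‖ ^ τ) • u - (‖v‖ ^ τ) • v‖ := by ring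

/-- Lower bound for the V-functional for `τ ≥ 0`, with constant depending only on `τ`. -/
theorem v_functional_lower_nonneg (τ : ℝ) (hτ : 0 ≤ τ) :
    ∃ c : ℝ, 0 < c ∧
      ∀ (X : Type*) [NormedAddCommGroup X] [NormedSpace ℝ X] (u v : X),
        c * (‖u‖ + ‖v‖) ^ τ * ‖u - v‖ ≤ ‖(‖u‖ ^ τ) • u - (‖v‖ ^ τ) • v‖ := by
  refine ⟨(2 * 2 ^ τ)⁻¹, by positivity, fun X _ _ u v => ?_⟩
  rcases le_total ‖v‖ ‖u‖ with h | h
  · exact norm_add_norm_rpow_mul_norm_sub_le hτ h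
  · rw [add_comm, norm_sub_rev u v, norm_sub_rev ((‖u‖ ^ τ) • u)]
    exact norm_add_norm_rpow_mul_norm_sub_le hτ h
end

section
/- Let (X, ‖·‖) be a real normed space, let τ be a real number with −1 < τ < 0, and let λ ≥ 0 satisfy (1 + τ)(1 + λ) ≥ −τ. Then for all nonzero u, v ∈ X with ‖v‖ ≤ ‖u‖ one has (2 + λ) · ‖ ‖u‖^τ • u − ‖v‖^τ • v ‖ ≥ ‖u‖^τ · ‖u − v‖, and in particular (2 + λ) · ‖ ‖u‖^τ • u − ‖v‖^τ • v ‖ ≥ (‖u‖ + ‖v‖)^τ · ‖u − v‖. -/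
/-- Weighted AM-GM, rescaled: the weights are `1 + τ` and `-τ`. -/
theorem rpow_mul_self_le_weighted {a b τ : ℝ} (ha : 0 < a) (hb : 0 < b) (hτ1 : -1 ≤ τ)
    (hτ2 : τ ≤ 0) : b ^ τ * b ≤ a ^ τ * ((1 + τ) * b + -τ * a) := by
  have h := Real.geom_mean_le_arith_mean2_weighted (by linarith : 0 ≤ 1 + τ)
    (by linarith : 0 ≤ -τ) hb.le ha.le (by ring)
  calc b ^ τ * b = a ^ τ * (b ^ (1 + τ) * a ^ (-τ)) := by
        rw [Real.rpow_add hb, Real.rpow_one, Real.rpow_neg ha.le]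
        field_simp [(Real.rpow_pos_of_pos ha τ).ne']
    _ ≤ _ := mul_le_mul_of_nonneg_left h (Real.rpow_pos_of_pos ha τ).le


/-- Quantitative lower bound for the V-functional with `-1 < τ < 0`, with explicit
constant `2 + λ` where `(1 + τ)(1 + λ) ≥ -τ`. -/
theorem v_functional_lower_neg_explicit (X : Type*) [NormedAddCommGroup X] [NormedSpace ℝ X]
    (τ : ℝ) (hτ1 : -1 < τ) (hτ2 : τ < 0) (lam : ℝ) (hlam : 0 ≤ lam)
    (hcrit : (1 + τ) * (1 + lam) ≥ -τ) (u v : X) (hu : u ≠ 0) (hv : v ≠ 0)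
    (hvu : ‖v‖ ≤ ‖u‖) :
    (2 + lam) * ‖(‖u‖ ^ τ) • u - (‖v‖ ^ τ) • v‖ ≥ ‖u‖ ^ τ * ‖u - v‖ ∧
    (2 + lam) * ‖(‖u‖ ^ τ) • u - (‖v‖ ^ τ) • v‖ ≥ (‖u‖ + ‖v‖) ^ τ * ‖u - v‖ := by
  have ha : 0 < ‖u‖ := norm_pos_iff.mpr hu
  have hb : 0 < ‖v‖ := norm_pos_iff.mpr hv
  have hA : 0 < ‖u‖ ^ τ := Real.rpow_pos_of_pos ha τ
  have hB : 0 < ‖v‖ ^ τ := Real.rpow_pos_of_pos hb τ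
  have hAB : ‖u‖ ^ τ ≤ ‖v‖ ^ τ := Real.rpow_le_rpow_of_nonpos hb hvu hτ2.le
  have hamgm := rpow_mul_self_le_weighted ha hb hτ1.le hτ2.le
  have hlow : ‖u‖ ^ τ * ‖u‖ - ‖v‖ ^ τ * ‖v‖ ≤ ‖(‖u‖ ^ τ) • u - (‖v‖ ^ τ) • v‖ := by
    simpa [norm_smul, abs_of_pos hA, abs_of_pos hB] using
      norm_sub_norm_le ((‖u‖ ^ τ) • u) ((‖v‖ ^ τ) • v)
  have htri : ‖u‖ ^ τ * ‖u - v‖ ≤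
      ‖(‖u‖ ^ τ) • u - (‖v‖ ^ τ) • v‖ + (‖v‖ ^ τ - ‖u‖ ^ τ) * ‖v‖ := by
    have h := norm_add_le ((‖u‖ ^ τ) • u - (‖v‖ ^ τ) • v) ((‖v‖ ^ τ - ‖u‖ ^ τ) • v)
    have e : (‖u‖ ^ τ) • u - (‖v‖ ^ τ) • v + (‖v‖ ^ τ - ‖u‖ ^ τ) • v
        = (‖u‖ ^ τ) • (u - v) := by module
    rwa [e, norm_smul, norm_smul, Real.norm_of_nonneg hA.le,
      Real.norm_of_nonneg (sub_nonneg.mpr hAB)] at h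
  have hW := norm_nonneg ((‖u‖ ^ τ) • u - (‖v‖ ^ τ) • v)
  generalize ‖(‖u‖ ^ τ) • u - (‖v‖ ^ τ) • v‖ = W at hlow htri hW ⊢
  have hmid : (‖v‖ ^ τ - ‖u‖ ^ τ) * ‖v‖ ≤ (1 + lam) * W := by
    refine le_of_mul_le_mul_left ?_ (by linarith : 0 < 1 + τ)
    have h1 := mul_le_mul_of_nonneg_left hlow (by linarith : 0 ≤ -τ)
    have h2 := mul_le_mul_of_nonneg_right hcrit hW
    linarith
  have hmain : ‖u‖ ^ τ * ‖u - v‖ ≤ (2 + lam) * W := by linarith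
  refine ⟨hmain, le_trans ?_ hmain⟩
  exact mul_le_mul_of_nonneg_right
    (Real.rpow_le_rpow_of_nonpos ha (by linarith) hτ2.le) (norm_nonneg _)
end

section
/- Let τ be a real number with −1 < τ < 0 and let λ ≥ 0 satisfy (1 + τ)(1 + λ) ≥ −τ. Then for every real a > 0 and every real x with 0 < x ≤ a, one has (1 + λ) · a · x^(−τ−1) + x^(−τ) ≥ (2 + λ) · a^(−τ). -/
/-- For `-1 < τ < 0` and `λ ≥ 0` with `(1 + τ)(1 + λ) ≥ -τ`, the function
`f(x) = (1 + λ) a x^(-τ-1) + x^(-τ)` satisfies `f(x) ≥ (2 + λ) a^(-τ)` on `(0, a]`. -/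
theorem critical_point_inequality (τ lam : ℝ) (hτ1 : -1 < τ) (hτ2 : τ < 0)
    (hlam : 0 ≤ lam) (hcrit : (1 + τ) * (1 + lam) ≥ -τ)
    (a x : ℝ) (ha : 0 < a) (hx : 0 < x) (hxa : x ≤ a) :
    (1 + lam) * a * x ^ (-τ - 1) + x ^ (-τ) ≥ (2 + lam) * a ^ (-τ) := by
  have ht : 1 ≤ a / x := (one_le_div hx).2 hxa
  have hbern : (a / x) ^ (-τ) ≤ 1 + -τ * (a / x - 1) := by
    have h := rpow_one_add_le_one_add_mul_self (s := a / x - 1) (by linarith)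
      (p := -τ) (by linarith) (by linarith)
    rwa [add_sub_cancel] at h
  have hscaled : (2 + lam) * (a / x) ^ (-τ) ≤ (1 + lam) * (a / x) + 1 := by
    have h := mul_le_mul_of_nonneg_left hbern (by linarith : 0 ≤ 2 + lam)
    nlinarith [mul_nonneg (sub_nonneg.2 ht) (sub_nonneg.2 hcrit)]
  have hpos : 0 < x ^ (-τ) := Real.rpow_pos_of_pos hx _
  calc (1 + lam) * a * x ^ (-τ - 1) + x ^ (-τ)
      = ((1 + lam) * (a / x) + 1) * x ^ (-τ) := by
        rw [Real.rpow_sub_one hx.ne']; ring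
    _ ≥ (2 + lam) * (a / x) ^ (-τ) * x ^ (-τ) :=
        mul_le_mul_of_nonneg_right hscaled hpos.le
    _ = (2 + lam) * a ^ (-τ) := by
        rw [Real.div_rpow ha.le hx.le, mul_assoc, div_mul_cancel₀ _ hpos.ne']
end

section
/- Let τ be a real number with −1 < τ < 0 and let λ ≥ 0 satisfy (1 + τ)(1 + λ) ≥ −τ. Then for all reals a, b with 0 < b ≤ a, one has (1 + λ) · b^(−τ) · a − (2 + λ) · a^(−τ) · b + b^(1−τ) ≥ 0. -/
/-- For `-1 < τ < 0` and `λ ≥ 0` with `(1 + τ)(1 + λ) ≥ -τ`, and `0 < b ≤ a`,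
`(1 + λ) b^(-τ) a - (2 + λ) a^(-τ) b + b^(1-τ) ≥ 0`. -/
theorem scalar_convexity_inequality (τ lam : ℝ) (hτ1 : -1 < τ) (hτ2 : τ < 0)
    (hlam : 0 ≤ lam) (hcrit : (1 + τ) * (1 + lam) ≥ -τ)
    (a b : ℝ) (hb : 0 < b) (hba : b ≤ a) :
    (1 + lam) * b ^ (-τ) * a - (2 + lam) * a ^ (-τ) * b + b ^ (1 - τ) ≥ 0 := by
  obtain ⟨y, hy, rfl⟩ : ∃ y : ℝ, 0 ≤ y ∧ a = b * (1 + y) :=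
    ⟨a / b - 1, sub_nonneg.mpr ((one_le_div hb).mpr hba), by field_simp; ring⟩
  have bernoulli : (1 + y) ^ (-τ) ≤ 1 + -τ * y :=
    rpow_one_add_le_one_add_mul_self (by linarith) (by linarith) (by linarith)
  have scaled : 0 ≤ (1 + lam) * (1 + y) - (2 + lam) * (1 + y) ^ (-τ) + 1 := by
    have h₁ := mul_le_mul_of_nonneg_left bernoulli (show 0 ≤ 2 + lam by linarith)
    have h₂ := mul_nonneg hy (sub_nonneg.mpr hcrit)
    linarith
  have hpow : b ^ (1 - τ) = b * b ^ (-τ) := by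
    rw [sub_eq_add_neg, Real.rpow_add hb, Real.rpow_one]
  rw [Real.mul_rpow hb.le (by linarith), hpow]
  have := mul_nonneg (mul_nonneg hb.le (Real.rpow_nonneg hb.le (-τ))) scaled
  linarith
end

section
/- Let (X, ‖·‖) be a real Banach space, let τ be a real number with 1 < τ ≤ 2, and let n be a positive natural number. Suppose there is a constant C > 0 such that (1/2)(‖x + y‖ + ‖x − y‖ − 2) ≤ C ‖y‖^τ for all x, y ∈ X with ‖x‖ = 1 (that is, the modulus of smoothness of ‖·‖ satisfies τ_ρ(ε) ≤ C ε^τ for all ε > 0, so X is τ-smooth). Then the norm F(x₁,…,xₙ) = (∑ i, ‖xᵢ‖²)^(1/2) on Xⁿ (the PiLp 2 product of n copies of X) is also τ-smooth: there is a constant C' > 0 such that (1/2)(F(X + Y) + F(X − Y) − 2) ≤ C' F(Y)^τ for all X, Y ∈ Xⁿ with F(X) = 1. -/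
/-- In a `τ`-smooth normed space, `‖p + q‖² + ‖p - q‖²` exceeds `2‖p‖²` by at most a constant
multiple of `‖q‖^τ` for `p`, `q` in the unit ball. -/
theorem sq_norm_add_add_sq_norm_sub_le {X : Type*} [NormedAddCommGroup X] [NormedSpace ℝ X]
    {τ C : ℝ} (hτ2 : τ ≤ 2) (hC : 0 < C)
    (h : ∀ x y : X, ‖x‖ = 1 → (1 / 2) * (‖x + y‖ + ‖x - y‖ - 2) ≤ C * ‖y‖ ^ τ)
    {p q : X} (hp : ‖p‖ ≤ 1) (hq : ‖q‖ ≤ 1) :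
    ‖p + q‖ ^ 2 + ‖p - q‖ ^ 2 ≤ 2 * ‖p‖ ^ 2 + (4 + 4 * C) * ‖q‖ ^ τ := by
  have hsq : ∀ t : ℝ, 0 ≤ t → t ≤ 1 → t ^ 2 ≤ t ^ τ := fun t h0 h1 => by
    rw [← Real.rpow_two]
    exact Real.rpow_le_rpow_of_exponent_ge_of_imp h0 h1 hτ2 (fun _ h => by linarith)
  have hvτ : 0 ≤ ‖q‖ ^ τ := by positivity
  have key : ‖p‖ * ((‖p + q‖ + ‖p - q‖) / 2 - ‖p‖) ≤ C * ‖q‖ ^ τ := by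
    rcases (norm_nonneg p).eq_or_lt with h0 | h0
    · rw [← h0, zero_mul]
      positivity
    · have hn : ‖‖p‖⁻¹ • p‖ = 1 := by
        rw [norm_smul, norm_inv, norm_norm, inv_mul_cancel₀ h0.ne']
      have hs := h (‖p‖⁻¹ • p) (‖p‖⁻¹ • q) hn
      rw [← smul_add, ← smul_sub, norm_smul, norm_smul, norm_smul, norm_inv, norm_norm,
        Real.mul_rpow (by positivity) (by positivity), Real.inv_rpow h0.le] at hs
      have hu : ‖p‖ ^ 2 * (‖p‖ ^ τ)⁻¹ ≤ 1 := by
        rw [← div_eq_mul_inv]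
        exact div_le_one_of_le₀ (hsq _ h0.le hp) (by positivity)
      calc ‖p‖ * ((‖p + q‖ + ‖p - q‖) / 2 - ‖p‖)
          = ‖p‖ ^ 2 * (1 / 2 * (‖p‖⁻¹ * ‖p + q‖ + ‖p‖⁻¹ * ‖p - q‖ - 2)) := by
            field_simp
        _ ≤ ‖p‖ ^ 2 * (C * ((‖p‖ ^ τ)⁻¹ * ‖q‖ ^ τ)) := by gcongr
        _ = (‖p‖ ^ 2 * (‖p‖ ^ τ)⁻¹) * (C * ‖q‖ ^ τ) := by ring
        _ ≤ 1 * (C * ‖q‖ ^ τ) := by gcongr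
        _ = C * ‖q‖ ^ τ := one_mul _
  have h1 : ‖p + q‖ ≤ ‖p‖ + ‖q‖ := norm_add_le p q
  have h2 : ‖p - q‖ ≤ ‖p‖ + ‖q‖ := norm_sub_le p q
  have h3 : ‖p‖ ≤ ‖p + q‖ + ‖q‖ := by simpa using norm_sub_le (p + q) q
  have h4 : ‖p‖ ≤ ‖p - q‖ + ‖q‖ := by simpa using norm_add_le (p - q) q
  have hq2 := hsq _ (norm_nonneg q) hq
  have hs : ((‖p + q‖ + ‖p - q‖) / 2 - ‖p‖) ^ 2 ≤ ‖q‖ ^ 2 :=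
    sq_le_sq' (by linarith) (by linarith)
  have hd : ((‖p + q‖ - ‖p - q‖) / 2) ^ 2 ≤ ‖q‖ ^ 2 :=
    sq_le_sq' (by linarith) (by linarith)
  nlinarith


/-- If the norm of a real Banach space `X` is `τ`-smooth (modulus of smoothness `≲ ε^τ`),
then the `ℓ²`-product norm `F(x) = (∑ ‖xᵢ‖²)^(1/2)` on `Xⁿ` is also `τ`-smooth. -/
theorem piLp_two_tau_smooth (X : Type*) [NormedAddCommGroup X] [NormedSpace ℝ X]
    [CompleteSpace X] (τ : ℝ) (hτ1 : 1 < τ) (hτ2 : τ ≤ 2) (n : ℕ) (hn : 0 < n)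
    (C : ℝ) (hC : 0 < C)
    (h : ∀ x y : X, ‖x‖ = 1 → (1 / 2) * (‖x + y‖ + ‖x - y‖ - 2) ≤ C * ‖y‖ ^ τ) :
    ∃ C' : ℝ, 0 < C' ∧
      ∀ P Q : PiLp 2 (fun _ : Fin n => X), ‖P‖ = 1 →
        (1 / 2) * (‖P + Q‖ + ‖P - Q‖ - 2) ≤ C' * ‖Q‖ ^ τ := by
  have hn' : (0 : ℝ) < n := by exact_mod_cast hn
  refine ⟨1 + (1 + C) * n, by positivity, fun P Q hP => ?_⟩
  have hε : 0 ≤ ‖Q‖ ^ τ := by positivity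
  rcases le_total ‖Q‖ 1 with hQ | hQ
  · have hsum : ‖P + Q‖ ^ 2 + ‖P - Q‖ ^ 2 ≤ 2 * ‖P‖ ^ 2 + (4 + 4 * C) * (n * ‖Q‖ ^ τ) := by
      calc ‖P + Q‖ ^ 2 + ‖P - Q‖ ^ 2 = ∑ i, (‖P i + Q i‖ ^ 2 + ‖P i - Q i‖ ^ 2) := by
            simp [PiLp.norm_sq_eq_of_L2, Finset.sum_add_distrib]
        _ ≤ ∑ i, (2 * ‖P i‖ ^ 2 + (4 + 4 * C) * ‖Q‖ ^ τ) := by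
            refine Finset.sum_le_sum fun i _ => ?_
            have hPi := PiLp.norm_apply_le P i
            have hQi := PiLp.norm_apply_le Q i
            refine (sq_norm_add_add_sq_norm_sub_le hτ2 hC h (hPi.trans hP.le)
              (hQi.trans hQ)).trans ?_
            gcongr
        _ = 2 * ‖P‖ ^ 2 + (4 + 4 * C) * (n * ‖Q‖ ^ τ) := by
            simp [PiLp.norm_sq_eq_of_L2, Finset.sum_add_distrib, Finset.mul_sum]
            ring
    rw [hP] at hsum
    nlinarith [sq_nonneg (‖P + Q‖ + ‖P - Q‖ - 2), sq_nonneg (‖P + Q‖ - ‖P - Q‖)]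
  · have h1 := norm_add_le P Q
    have h2 := norm_sub_le P Q
    have h3 : ‖Q‖ ≤ ‖Q‖ ^ τ := Real.self_le_rpow_of_one_le hQ hτ1.le
    have h4 : 0 ≤ (1 + C) * n * ‖Q‖ ^ τ := by positivity
    linarith
end

section
/- Let (X, ‖·‖) be a real Banach space, let σ ≥ 2 be a real number, and let n be a positive natural number. Suppose there is a constant c > 0 such that 1 − ‖(x + y)/2‖ ≥ c ε^σ for all ε ∈ [0,2] and all x, y ∈ X with ‖x‖ = ‖y‖ = 1 and ‖x − y‖ ≥ ε (that is, the modulus of convexity of ‖·‖ satisfies σ_ρ(ε) ≥ c ε^σ, so X is σ-convex). Then the norm F(x₁,…,xₙ) = (∑ i, ‖xᵢ‖²)^(1/2) on Xⁿ (the PiLp 2 product of n copies of X) is also σ-convex: there is a constant c' > 0 such that 1 − F((X + Y)/2) ≥ c' ε^σ for all ε ∈ [0,2] and all X, Y ∈ Xⁿ with F(X) = F(Y) = 1 and F(X − Y) ≥ ε. -/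
lemma norm_midpoint_sq_le_of_norm_le {X : Type*} [NormedAddCommGroup X] [NormedSpace ℝ X]
    {σ c : ℝ} (hσ : 2 ≤ σ) (hc : 0 < c)
    (h : ∀ x y : X, ‖x‖ = 1 → ‖y‖ = 1 → c * ‖x - y‖ ^ σ ≤ 1 - ‖(1 / 2 : ℝ) • (x + y)‖)
    {x y : X} (hx : ‖x‖ ≤ 1) (hyx : ‖y‖ ≤ ‖x‖) :
    ‖(1 / 2 : ℝ) • (x + y)‖ ^ 2 ≤ (‖x‖ ^ 2 + ‖y‖ ^ 2) / 2
      - min (c * (3 / 4) ^ σ) (((2 : ℝ) ^ σ)⁻¹ / 16) * ‖x - y‖ ^ σ := by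
  set K := min (c * (3 / 4 : ℝ) ^ σ) (((2 : ℝ) ^ σ)⁻¹ / 16)
  set d := ‖x - y‖ with hd
  have hd0 : 0 ≤ d := norm_nonneg _
  have hd2 : d ≤ ‖x‖ + ‖y‖ := norm_sub_le _ _
  have hmid (u v : X) : ‖(1 / 2 : ℝ) • (u + v)‖ = ‖u + v‖ / 2 := by
    rw [norm_smul]; norm_num; ring
  rw [hmid]
  have hs0 : 0 ≤ ‖x + y‖ := norm_nonneg _
  have hs : ‖x + y‖ ≤ ‖x‖ + ‖y‖ := norm_add_le _ _
  have hb0 : 0 ≤ ‖y‖ := norm_nonneg _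
  have hdσ : 0 ≤ d ^ σ := Real.rpow_nonneg hd0 _
  by_cases hcase : d / 4 ≤ ‖x‖ - ‖y‖
  · have hpow : d ^ σ ≤ 2 ^ σ * (d / 2) ^ 2 := by
      have hle : (d / 2) ^ σ ≤ (d / 2) ^ (2 : ℝ) :=
        Real.rpow_le_rpow_of_exponent_ge_of_imp (by positivity) (by linarith) hσ
          (fun _ h0 => absurd h0 (by linarith))
      rw [Real.rpow_two, Real.div_rpow hd0 (by norm_num),
        div_le_iff₀ (by positivity)] at hle
      linarith
    have hK : K * d ^ σ ≤ d ^ 2 / 64 := by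
      calc K * d ^ σ ≤ ((2 : ℝ) ^ σ)⁻¹ / 16 * (2 ^ σ * (d / 2) ^ 2) :=
            mul_le_mul (min_le_right _ _) hpow hdσ (by positivity)
        _ = d ^ 2 / 64 := by field_simp; ring
    nlinarith [mul_self_le_mul_self (by positivity : 0 ≤ d / 4) hcase,
      mul_self_le_mul_self hs0 hs]
  · push Not at hcase
    have hb : 0 < ‖y‖ := by linarith
    have ha : 0 < ‖x‖ := hb.trans_le hyx
    set a := ‖x‖
    set b := ‖y‖
    set u := a⁻¹ • x
    set v := b⁻¹ • y
    have hu : ‖u‖ = 1 := by rw [norm_smul, norm_inv, norm_norm, inv_mul_cancel₀ ha.ne']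
    have hv : ‖v‖ = 1 := by rw [norm_smul, norm_inv, norm_norm, inv_mul_cancel₀ hb.ne']
    have hxu : x = a • u := (smul_inv_smul₀ ha.ne' x).symm
    have hyv : y = b • v := (smul_inv_smul₀ hb.ne' y).symm
    have huv := h u v hu hv
    rw [hmid] at huv
    have hau : ‖(a - b) • u‖ = a - b := by
      rw [norm_smul, hu, mul_one, Real.norm_of_nonneg (by linarith)]
    have hsub : d ≤ b * ‖u - v‖ + (a - b) := by
      calc d = ‖b • (u - v) + (a - b) • u‖ := by
            rw [hd, hxu, hyv]; congr 1; module
        _ ≤ _ := (norm_add_le _ _).trans_eq (by rw [hau, norm_smul, Real.norm_of_nonneg hb0])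
    have hadd : ‖x + y‖ ≤ b * ‖u + v‖ + (a - b) := by
      calc ‖x + y‖ = ‖b • (u + v) + (a - b) • u‖ := by
            rw [hxu, hyv]; congr 1; module
        _ ≤ _ := (norm_add_le _ _).trans_eq (by rw [hau, norm_smul, Real.norm_of_nonneg hb0])
    have hpow : (3 / 4) ^ σ * d ^ σ ≤ b ^ 2 * ‖u - v‖ ^ σ := by
      calc (3 / 4) ^ σ * d ^ σ = (3 / 4 * d) ^ σ := (Real.mul_rpow (by norm_num) hd0).symm
        _ ≤ (b * ‖u - v‖) ^ σ :=
            Real.rpow_le_rpow (by positivity) (by linarith) (by linarith)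
        _ = b ^ σ * ‖u - v‖ ^ σ := Real.mul_rpow hb0 (norm_nonneg _)
        _ ≤ b ^ 2 * ‖u - v‖ ^ σ := by
            gcongr
            rw [← Real.rpow_two]
            exact Real.rpow_le_rpow_of_exponent_ge hb (hyx.trans hx) hσ
    have hK : K * d ^ σ ≤ b * (b * (c * ‖u - v‖ ^ σ)) := by
      calc K * d ^ σ ≤ c * (3 / 4) ^ σ * d ^ σ := by gcongr; exact min_le_left _ _
        _ = c * ((3 / 4) ^ σ * d ^ σ) := by ring
        _ ≤ c * (b ^ 2 * ‖u - v‖ ^ σ) := by gcongr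
        _ = _ := by ring
    set g := b * (c * ‖u - v‖ ^ σ)
    have hg0 : 0 ≤ g := by positivity
    have hsg : ‖x + y‖ / 2 ≤ (a + b) / 2 - g := by
      have := mul_le_mul_of_nonneg_left huv hb0
      simp only [g]
      linarith
    calc (‖x + y‖ / 2) ^ 2 = ‖x + y‖ / 2 * (‖x + y‖ / 2) := sq _
      _ ≤ (a + b) / 2 * ((a + b) / 2 - g) := by gcongr
      _ ≤ (a ^ 2 + b ^ 2) / 2 - b * g := by
          nlinarith [sq_nonneg (a - b), mul_nonneg (sub_nonneg.2 hyx) hg0]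
      _ ≤ _ := by linarith

/-- If the norm of a real Banach space `X` is `σ`-convex (modulus of convexity `≳ ε^σ`),
then the `ℓ²`-product norm `F(x) = (∑ ‖xᵢ‖²)^(1/2)` on `Xⁿ` is also `σ`-convex. -/
theorem piLp_two_sigma_convex (X : Type*) [NormedAddCommGroup X] [NormedSpace ℝ X]
    [CompleteSpace X] (σ : ℝ) (hσ : 2 ≤ σ) (n : ℕ) (hn : 0 < n)
    (c : ℝ) (hc : 0 < c)
    (h : ∀ ε : ℝ, 0 ≤ ε → ε ≤ 2 → ∀ x y : X, ‖x‖ = 1 → ‖y‖ = 1 → ε ≤ ‖x - y‖ →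
      c * ε ^ σ ≤ 1 - ‖(1 / 2 : ℝ) • (x + y)‖) :
    ∃ c' : ℝ, 0 < c' ∧
      ∀ ε : ℝ, 0 ≤ ε → ε ≤ 2 → ∀ P Q : PiLp 2 (fun _ : Fin n => X),
        ‖P‖ = 1 → ‖Q‖ = 1 → ε ≤ ‖P - Q‖ →
          c' * ε ^ σ ≤ 1 - ‖(1 / 2 : ℝ) • (P + Q)‖ := by
  set K := min (c * (3 / 4 : ℝ) ^ σ) (((2 : ℝ) ^ σ)⁻¹ / 16)
  have hK : 0 < K := by positivity
  have hn' : (0 : ℝ) < n := by exact_mod_cast hn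
  have hunit (x y : X) (hx : ‖x‖ = 1) (hy : ‖y‖ = 1) :
      c * ‖x - y‖ ^ σ ≤ 1 - ‖(1 / 2 : ℝ) • (x + y)‖ :=
    h _ (norm_nonneg _) ((norm_sub_le x y).trans (by rw [hx, hy]; norm_num)) x y hx hy le_rfl
  have hball (x y : X) (hx : ‖x‖ ≤ 1) (hy : ‖y‖ ≤ 1) :
      ‖(1 / 2 : ℝ) • (x + y)‖ ^ 2 ≤ (‖x‖ ^ 2 + ‖y‖ ^ 2) / 2 - K * ‖x - y‖ ^ σ := by
    rcases le_total ‖y‖ ‖x‖ with hxy | hxy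
    · exact norm_midpoint_sq_le_of_norm_le hσ hc hunit hx hxy
    · rw [add_comm x, add_comm (‖x‖ ^ 2), norm_sub_rev]
      exact norm_midpoint_sq_le_of_norm_le hσ hc hunit hy hxy
  refine ⟨K * ((√n) ^ σ)⁻¹ / 2, by positivity, fun ε hε _ P Q hP hQ hPQ => ?_⟩
  have hsum : ‖(1 / 2 : ℝ) • (P + Q)‖ ^ 2 ≤ 1 - K * ∑ i, ‖P i - Q i‖ ^ σ := by
    calc ‖(1 / 2 : ℝ) • (P + Q)‖ ^ 2 = ∑ i, ‖(1 / 2 : ℝ) • (P i + Q i)‖ ^ 2 :=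
          PiLp.norm_sq_eq_of_L2 _ _
      _ ≤ ∑ i, ((‖P i‖ ^ 2 + ‖Q i‖ ^ 2) / 2 - K * ‖P i - Q i‖ ^ σ) :=
          Finset.sum_le_sum fun i _ => hball _ _
            ((PiLp.norm_apply_le P i).trans hP.le) ((PiLp.norm_apply_le Q i).trans hQ.le)
      _ = (‖P‖ ^ 2 + ‖Q‖ ^ 2) / 2 - K * ∑ i, ‖P i - Q i‖ ^ σ := by
          rw [Finset.sum_sub_distrib, ← Finset.sum_div, Finset.sum_add_distrib, ← Finset.mul_sum,
            PiLp.norm_sq_eq_of_L2, PiLp.norm_sq_eq_of_L2]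
      _ = _ := by rw [hP, hQ]; norm_num
  obtain ⟨i, hi⟩ : ∃ i, ε / √n ≤ ‖P i - Q i‖ := by
    have : Nonempty (Fin n) := ⟨⟨0, hn⟩⟩
    obtain ⟨i, -, hi⟩ := Finset.exists_le_of_sum_le (s := Finset.univ)
      (f := fun _ : Fin n => (ε / √n) ^ 2) (g := fun i => ‖P i - Q i‖ ^ 2)
      Finset.univ_nonempty (by
        calc ∑ _ : Fin n, (ε / √n) ^ 2 = ε ^ 2 := by
              simp [div_pow]; field_simp
          _ ≤ ‖P - Q‖ ^ 2 := by gcongr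
          _ = _ := PiLp.norm_sq_eq_of_L2 _ _)
    exact ⟨i, (sq_le_sq₀ (by positivity) (norm_nonneg _)).1 hi⟩
  have hεσ : ((√n) ^ σ)⁻¹ * ε ^ σ ≤ ∑ i, ‖P i - Q i‖ ^ σ := by
    calc ((√n) ^ σ)⁻¹ * ε ^ σ = (ε / √n) ^ σ := by
          rw [Real.div_rpow hε (by positivity)]; ring
      _ ≤ ‖P i - Q i‖ ^ σ := Real.rpow_le_rpow (by positivity) hi (by linarith)
      _ ≤ _ := Finset.single_le_sum (f := fun i => ‖P i - Q i‖ ^ σ)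
          (fun _ _ => by positivity) (Finset.mem_univ i)
  have := mul_le_mul_of_nonneg_left hεσ hK.le
  nlinarith [sq_nonneg (1 - ‖(1 / 2 : ℝ) • (P + Q)‖)]
end
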